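/- Let A be an n×n real matrix with p distinct (complex) eigenvalues, of which λ_1,…,λ_{p_r} are real and (λ_{p_r+j}, λ_{p_r+j+p_c/2}) are complex-conjugate pairs for j = 1,…,p_c/2 (so p = p_r + p_c), with geometric multiplicities k_i and maximum geometric multiplicity k_max. Suppose there is a unique index i* ∈ {1,…,p_r + p_c/2} with k_{i*} = k_max, and that Σ_{i ∈ {1,…,p_r+p_c/2} \ {i*}} k_i(k_i − 1)/2 < k_max. Then for every l ≥ k_max, the l-MSCP optimum of A equals the MACP optimum of A. -/

import Mathlib

open Matrix

noncomputable section

/-- The controllability matrix `[B, AB, A²B, …, A^{n-1}B]`, as an `n × (n·l)` matrix. -/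
def ctrbMat {R : Type} [CommRing R] {n l : ℕ} (A : Matrix (Fin n) (Fin n) R)
    (B : Matrix (Fin n) (Fin l) R) : Matrix (Fin n) (Fin n × Fin l) R :=
  Matrix.of fun i jk => (A ^ (jk.1 : ℕ) * B) i jk.2

/-- `(A, B)` is controllable iff the controllability matrix has rank `n`. -/
def Controllable {R : Type} [CommRing R] {n l : ℕ} (A : Matrix (Fin n) (Fin n) R)
    (B : Matrix (Fin n) (Fin l) R) : Prop :=
  (ctrbMat A B).rank = n

/-- The columns of a matrix, as vectors. -/
def matCols {R : Type} [CommRing R] {n k : ℕ} (X : Matrix (Fin n) (Fin k) R) :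
    Fin k → (Fin n → R) := fun j i => X i j

/-- `X` is an `n × k` matrix whose columns are a basis of the λ-eigenspace of `Aᵀ`
(equivalently, its columns are `k` linearly independent left eigenvectors of `A`
for `μ`, spanning the whole left eigenspace; in particular `k` is the geometric
multiplicity of `μ`). -/
def IsLeftEigenbasis {n k : ℕ} (A : Matrix (Fin n) (Fin n) ℂ) (μ : ℂ)
    (X : Matrix (Fin n) (Fin k) ℂ) : Prop :=
  LinearIndependent ℂ (matCols X) ∧
  (∀ j, A.transpose.mulVec (matCols X j) = μ • matCols X j) ∧
  (∀ v : Fin n → ℂ, A.transpose.mulVec v = μ • v →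
      v ∈ Submodule.span ℂ (Set.range (matCols X)))

/-- The submatrix of `M` consisting of the columns indexed by `S`. -/
def colSub {R : Type} [CommRing R] {m n : ℕ} (M : Matrix (Fin m) (Fin n) R)
    (S : Finset (Fin n)) : Matrix (Fin m) {x // x ∈ S} R :=
  M.submatrix id (fun j => (j : Fin n))

/-- `H = {J ⊆ {1,…,n} : |J| = k and the k×k submatrix of Xᵀ formed by the columns
indexed by J is invertible}` (invertibility of the square submatrix is expressed
as full rank `k`). -/
def Hset {n k : ℕ} (X : Matrix (Fin n) (Fin k) ℂ) : Set (Finset (Fin n)) :=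
  {J | J.card = k ∧ (colSub X.transpose J).rank = k}

/-- The diagonal 0/1 matrix `I_S` selecting the states in `S`. -/
def diagSel {n : ℕ} (S : Finset (Fin n)) : Matrix (Fin n) (Fin n) ℝ :=
  Matrix.diagonal (fun j => if j ∈ S then (1 : ℝ) else 0)

/-- `‖B‖₀`, the number of nonzero entries of `B`. -/
def sparsity {n l : ℕ} (B : Matrix (Fin n) (Fin l) ℝ) : ℕ :=
  (Finset.univ.filter fun jc : Fin n × Fin l => B jc.1 jc.2 ≠ 0).card

/-- The MACP optimum: the minimal cardinality of a set `S` of actuated states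
such that `(A, I_S)` is controllable. -/
def MACPopt {n : ℕ} (A : Matrix (Fin n) (Fin n) ℝ) : ℕ :=
  sInf {m | ∃ S : Finset (Fin n), Controllable A (diagSel S) ∧ S.card = m}

/-- The `l`-MSCP optimum: the minimal number of nonzero entries of an `n × l`
real matrix `B` such that `(A, B)` is controllable. -/
def MSCPopt {n : ℕ} (A : Matrix (Fin n) (Fin n) ℝ) (l : ℕ) : ℕ :=
  sInf {m | ∃ B : Matrix (Fin n) (Fin l) ℝ, Controllable A B ∧ sparsity B = m}

lemma rank_eq_iff_vecMul_eq_zero {K : Type*} [Field K] {n : ℕ} {m : Type*} [Fintype m]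
    (M : Matrix (Fin n) m K) :
    M.rank = n ↔ ∀ v : Fin n → K, v ᵥ* M = 0 → v = 0 := by
  have h := LinearMap.finrank_range_add_finrank_ker Mᵀ.mulVecLin
  rw [Module.finrank_fin_fun] at h
  rw [← rank_transpose, Matrix.rank]
  have h2 : (∀ v : Fin n → K, v ᵥ* M = 0 → v = 0) ↔ LinearMap.ker Mᵀ.mulVecLin = ⊥ := by
    rw [LinearMap.ker_eq_bot']
    simp
  rw [h2, ← Submodule.finrank_eq_zero]
  omega

lemma vecMul_ctrbMat_eq_zero_iff {R : Type} [CommRing R] {n l : ℕ}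
    (A : Matrix (Fin n) (Fin n) R) (B : Matrix (Fin n) (Fin l) R) (v : Fin n → R) :
    v ᵥ* ctrbMat A B = 0 ↔ ∀ j < n, v ᵥ* (A ^ j * B) = 0 := by
  constructor
  · intro h j hj
    funext c
    exact congrFun h (⟨j, hj⟩, c)
  · intro h
    funext jc
    exact congrFun (h jc.1 jc.1.2) jc.2

/-- The left kernel of the controllability matrix annihilates `A ^ j * B` for every `j`. -/
lemma vecMul_pow_mul_eq_zero {R : Type} [CommRing R] {n l : ℕ}
    {A : Matrix (Fin n) (Fin n) R} {B : Matrix (Fin n) (Fin l) R} {v : Fin n → R}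
    (h : ∀ j < n, v ᵥ* (A ^ j * B) = 0) (j : ℕ) : v ᵥ* (A ^ j * B) = 0 := by
  nontriviality R
  rw [Matrix.pow_eq_aeval_mod_charpoly, Polynomial.aeval_eq_sum_range, Matrix.sum_mul,
    Matrix.vecMul_sum]
  refine Finset.sum_eq_zero fun i hi => ?_
  rw [Matrix.smul_mul, Matrix.vecMul_smul]
  by_cases hin : i < n
  · rw [h i hin, smul_zero]
  · rw [Polynomial.coeff_eq_zero_of_degree_lt, zero_smul]
    refine (Polynomial.degree_modByMonic_lt _ A.charpoly_monic).trans_le ?_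
    rw [Matrix.charpoly_degree_eq_dim, Fintype.card_fin]
    exact_mod_cast not_lt.mp hin

/-- The Popov–Belevitch–Hautus test over an algebraically closed field. -/
lemma controllable_iff_forall_eigenvector {K : Type} [Field K] [IsAlgClosed K] {n l : ℕ}
    (A : Matrix (Fin n) (Fin n) K) (B : Matrix (Fin n) (Fin l) K) :
    Controllable A B ↔
      ∀ (z : K) (v : Fin n → K), v ᵥ* A = z • v → v ᵥ* B = 0 → v = 0 := by
  rw [Controllable, rank_eq_iff_vecMul_eq_zero]
  simp only [vecMul_ctrbMat_eq_zero_iff]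
  constructor
  · intro h z v hA hB
    refine h v fun j _ => ?_
    have hpow : ∀ j : ℕ, v ᵥ* A ^ j = z ^ j • v := fun j => by
      induction j with
      | zero => simp
      | succ j ih =>
        rw [pow_succ, ← Matrix.vecMul_vecMul, ih, Matrix.smul_vecMul, hA, smul_smul, pow_succ]
    rw [← Matrix.vecMul_vecMul, hpow j, Matrix.smul_vecMul, hB, smul_zero]
  · intro h v hv
    by_contra hv0
    let W : Submodule K (Fin n → K) := ⨅ j : ℕ, LinearMap.ker (A ^ j * B).vecMulLinear
    have hW : ∀ w, w ∈ W ↔ ∀ j : ℕ, w ᵥ* (A ^ j * B) = 0 := fun w => by simp [W]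
    have hinv : ∀ w ∈ W, A.vecMulLinear w ∈ W := fun w hw => by
      rw [hW] at hw ⊢
      intro j
      rw [Matrix.vecMulLinear_apply, Matrix.vecMul_vecMul, ← Matrix.mul_assoc, ← pow_succ']
      exact hw (j + 1)
    have hvW : v ∈ W := (hW v).2 (vecMul_pow_mul_eq_zero hv)
    have : Nontrivial W := ⟨⟨v, hvW⟩, 0, fun he => hv0 (congrArg Subtype.val he)⟩
    obtain ⟨z, hz⟩ := Module.End.exists_eigenvalue (A.vecMulLinear.restrict hinv)
    obtain ⟨w, hw⟩ := hz.exists_hasEigenvector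
    refine hw.2 (Subtype.ext (h z w ?_ ?_))
    · exact congrArg Subtype.val hw.apply_eq_smul
    · simpa using (hW w).1 w.2 0

lemma vecMul_ofReal_eq_zero_iff {n : ℕ} {m : Type*} (M : Matrix (Fin n) m ℝ)
    (v : Fin n → ℂ) :
    v ᵥ* M.map Complex.ofReal = 0 ↔
      (fun i => (v i).re) ᵥ* M = 0 ∧ (fun i => (v i).im) ᵥ* M = 0 := by
  simp only [funext_iff, ← forall_and, Matrix.vecMul, dotProduct, Matrix.map_apply, Pi.zero_apply,
    Complex.ext_iff, Complex.re_sum, Complex.im_sum, Complex.re_mul_ofReal, Complex.im_mul_ofReal,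
    Complex.zero_re, Complex.zero_im]

lemma controllable_map_ofReal {n l : ℕ} (A : Matrix (Fin n) (Fin n) ℝ)
    (B : Matrix (Fin n) (Fin l) ℝ) :
    Controllable (A.map Complex.ofReal) (B.map Complex.ofReal) ↔ Controllable A B := by
  have hmap : ctrbMat (A.map Complex.ofReal) (B.map Complex.ofReal) =
      (ctrbMat A B).map Complex.ofReal := by
    ext i jk
    have : A.map Complex.ofReal ^ (jk.1 : ℕ) * B.map Complex.ofReal =
        (A ^ (jk.1 : ℕ) * B).map Complex.ofRealHom := by
      rw [Matrix.map_mul, Matrix.map_pow]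
      rfl
    exact congrFun (congrFun this i) jk.2
  rw [Controllable, Controllable, hmap, rank_eq_iff_vecMul_eq_zero, rank_eq_iff_vecMul_eq_zero]
  simp only [vecMul_ofReal_eq_zero_iff]
  constructor
  · intro h v hv
    have := h (fun i => (v i : ℂ)) (by
      refine ⟨by simpa using hv, ?_⟩
      simp only [Complex.ofReal_im]
      exact Matrix.zero_vecMul _)
    funext i
    exact Complex.ofReal_injective (congrFun this i)
  · rintro h v ⟨hre, him⟩
    funext i
    exact Complex.ext (congrFun (h _ hre) i) (congrFun (h _ him) i)

/-- The Popov–Belevitch–Hautus test for a real pair, in terms of complex eigenvectors. -/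
lemma controllable_real_iff {n l : ℕ} (A : Matrix (Fin n) (Fin n) ℝ)
    (B : Matrix (Fin n) (Fin l) ℝ) :
    Controllable A B ↔ ∀ (z : ℂ) (v : Fin n → ℂ), v ᵥ* A.map Complex.ofReal = z • v →
      v ᵥ* B.map Complex.ofReal = 0 → v = 0 := by
  rw [← controllable_map_ofReal, controllable_iff_forall_eigenvector]

lemma vecMul_diagSel_eq_zero_iff {n : ℕ} (S : Finset (Fin n)) (v : Fin n → ℂ) :
    v ᵥ* (diagSel S).map Complex.ofReal = 0 ↔ ∀ s ∈ S, v s = 0 := by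
  have hd : (diagSel S).map Complex.ofReal =
      Matrix.diagonal (fun j => if j ∈ S then (1 : ℂ) else 0) := by
    rw [diagSel, Matrix.diagonal_map Complex.ofReal_zero]
    congr 1
    funext j
    split_ifs <;> simp
  rw [hd]
  simp [funext_iff, Matrix.vecMul_diagonal]

lemma controllable_diagSel_iff {n : ℕ} (A : Matrix (Fin n) (Fin n) ℝ) (S : Finset (Fin n)) :
    Controllable A (diagSel S) ↔ ∀ (z : ℂ) (v : Fin n → ℂ),
      v ᵥ* A.map Complex.ofReal = z • v → (∀ s ∈ S, v s = 0) → v = 0 := by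
  simp only [controllable_real_iff, vecMul_diagSel_eq_zero_iff]

/-- The rows actuated by a controllable input matrix form a controllable state selection. -/
lemma MACPopt_le_sparsity {n l : ℕ} {A : Matrix (Fin n) (Fin n) ℝ}
    {B : Matrix (Fin n) (Fin l) ℝ} (h : Controllable A B) : MACPopt A ≤ sparsity B := by
  classical
  let S := (Finset.univ.filter fun jc : Fin n × Fin l => B jc.1 jc.2 ≠ 0).image Prod.fst
  have hS : Controllable A (diagSel S) := by
    rw [controllable_diagSel_iff]
    intro z v hA hv
    refine (controllable_real_iff A B).1 h z v hA (funext fun c => ?_)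
    rw [Matrix.vecMul, dotProduct, Pi.zero_apply]
    refine Finset.sum_eq_zero fun s _ => ?_
    by_cases hs : B s c = 0
    · simp [hs]
    · rw [hv s (Finset.mem_image.2 ⟨(s, c), by simpa using hs, rfl⟩), zero_mul]
  have hle : MACPopt A ≤ S.card := Nat.sInf_le ⟨S, hS, rfl⟩
  exact hle.trans Finset.card_image_le

lemma exists_controllable_diagSel_card_eq_MACPopt {n : ℕ} (A : Matrix (Fin n) (Fin n) ℝ) :
    ∃ S : Finset (Fin n), Controllable A (diagSel S) ∧ S.card = MACPopt A := by
  refine Nat.sInf_mem (s := {m | ∃ S : Finset (Fin n), Controllable A (diagSel S) ∧ S.card = m})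
    ⟨_, Finset.univ, (controllable_diagSel_iff A _).2 fun z v _ hv => ?_, rfl⟩
  exact funext fun s => hv s (Finset.mem_univ s)

/-- Coordinates separating a subspace can be thinned out to at most `finrank` many. -/
lemma exists_subset_card_le_finrank {K ι : Type*} [Field K] [Finite ι] (S : Finset ι)
    (W : Submodule K (ι → K)) (hW : ∀ v ∈ W, (∀ s ∈ S, v s = 0) → v = 0) :
    ∃ J ⊆ S, J.card ≤ Module.finrank K W ∧ ∀ v ∈ W, (∀ s ∈ J, v s = 0) → v = 0 := by
  classical
  induction hd : Module.finrank K W using Nat.strong_induction_on generalizing W with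
  | _ d ih =>
    by_cases hz : ∀ v ∈ W, v = 0
    · exact ⟨∅, by simp, by simp, fun v hv _ => hz v hv⟩
    · push Not at hz
      obtain ⟨v, hv, hv0⟩ := hz
      obtain ⟨s, hs, hvs⟩ : ∃ s ∈ S, v s ≠ 0 := by
        by_contra! hcon
        exact hv0 (hW v hv hcon)
      let W' : Submodule K (ι → K) := W ⊓ LinearMap.ker (LinearMap.proj (R := K) s)
      have hlt : Module.finrank K W' < d := by
        rw [← hd]
        refine Submodule.finrank_lt_finrank_of_lt (lt_of_le_of_ne inf_le_left fun he => ?_)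
        have : v ∈ W' := he ▸ hv
        exact hvs this.2
      obtain ⟨J, hJS, hJc, hJ⟩ := ih _ hlt W' (fun w hw => hW w hw.1) rfl
      refine ⟨insert s J, Finset.insert_subset hs hJS,
        (Finset.card_insert_le _ _).trans (by omega), fun w hw hwJ => ?_⟩
      exact hJ w ⟨hw, hwJ s (Finset.mem_insert_self _ _)⟩
        fun t ht => hwJ t (Finset.mem_insert_of_mem ht)

lemma sub_one_le_mul_sub_one_div_two (m : ℕ) : m - 1 ≤ m * (m - 1) / 2 := by
  rw [Nat.le_div_iff_mul_le two_pos]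
  match m with
  | 0 => simp
  | 1 => simp
  | m + 2 => simp; nlinarith

/-- A greedy colouring that is injective on a distinguished set and on each of finitely many
further sets containing few pairs in total. -/
lemma exists_coloring_injOn {α ι : Type*} [Finite α] [DecidableEq ι] {l : ℕ} (T : Finset ι)
    (J₀ : Finset α) (J : ι → Finset α) (h₀ : J₀.card ≤ l)
    (hsum : ∑ i ∈ T, (J i).card * ((J i).card - 1) / 2 < l) :
    ∃ c : α → Fin l, Set.InjOn c J₀ ∧ ∀ i ∈ T, Set.InjOn c (J i) := by
  classical
  have := Fintype.ofFinite α
  suffices h : ∀ U : Finset α, ∃ c : α → Fin l, Set.InjOn c J₀ ∧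
      ∀ i ∈ T, ∀ s ∈ J i, ∀ t ∈ J i, s ∈ J₀ ∪ U → t ∈ J₀ ∪ U → c s = c t → s = t by
    obtain ⟨c, hc, hT⟩ := h Finset.univ
    exact ⟨c, hc, fun i hi s hs t ht => hT i hi s hs t ht (by simp) (by simp)⟩
  intro U
  induction U using Finset.induction_on with
  | empty =>
    have : NeZero l := ⟨(Nat.zero_le _).trans_lt hsum |>.ne'⟩
    obtain ⟨e⟩ := Function.Embedding.nonempty_of_card_le (α := J₀) (β := Fin l) (by simpa using h₀)
    have hc : Set.InjOn (fun a => if h : a ∈ J₀ then e ⟨a, h⟩ else 0) J₀ := fun s hs t ht hst => by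
      rw [Finset.mem_coe] at hs ht
      simpa [hs, ht] using hst
    exact ⟨_, hc, fun i _ s _ t _ hs ht hst => hc (by simpa using hs) (by simpa using ht) hst⟩
  | insert a U _ ih =>
    obtain ⟨c, hc, hT⟩ := ih
    by_cases ha : a ∈ J₀
    · refine ⟨c, hc, ?_⟩
      have : J₀ ∪ insert a U = J₀ ∪ U := by grind
      rwa [this]
    let F : Finset α := (T.filter fun i => a ∈ J i).biUnion fun i => (J i).erase a
    have hF : (F.image c).card < (Finset.univ : Finset (Fin l)).card := by
      rw [Finset.card_univ, Fintype.card_fin]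
      refine lt_of_le_of_lt ?_ hsum
      refine Finset.card_image_le.trans (Finset.card_biUnion_le.trans ?_)
      refine (Finset.sum_le_sum fun i hi => ?_).trans
        (Finset.sum_le_sum_of_subset (Finset.filter_subset (fun i => a ∈ J i) T))
      rw [Finset.card_erase_of_mem (Finset.mem_filter.1 hi).2]
      exact sub_one_le_mul_sub_one_div_two _
    obtain ⟨x, -, hx⟩ := Finset.exists_mem_notMem_of_card_lt_card hF
    have hxF : ∀ i ∈ T, a ∈ J i → ∀ t ∈ J i, t ≠ a → c t ≠ x := by
      intro i hi hai t ht hta hct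
      refine hx (Finset.mem_image.2 ⟨t, Finset.mem_biUnion.2 ⟨i, ?_, ?_⟩, hct⟩)
      · exact Finset.mem_filter.2 ⟨hi, hai⟩
      · exact Finset.mem_erase.2 ⟨hta, ht⟩
    refine ⟨Function.update c a x, ?_, ?_⟩
    · intro s hs t ht hst
      have hsa : s ≠ a := by rintro rfl; exact ha hs
      have hta : t ≠ a := by rintro rfl; exact ha ht
      rw [Function.update_of_ne hsa, Function.update_of_ne hta] at hst
      exact hc hs ht hst
    · intro i hi s hs t ht hsU htU hst
      by_cases hsa : s = a
      · by_cases hta : t = a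
        · rw [hsa, hta]
        · subst hsa
          rw [Function.update_self, Function.update_of_ne hta] at hst
          exact absurd hst.symm (hxF i hi hs t ht hta)
      · by_cases hta : t = a
        · subst hta
          rw [Function.update_self, Function.update_of_ne hsa] at hst
          exact absurd hst (hxF i hi ht s hs hsa)
        · rw [Function.update_of_ne hsa, Function.update_of_ne hta] at hst
          exact hT i hi s hs t ht (by grind) (by grind) hst

/-- The input matrix in which state `s ∈ S` is actuated through input `c s` with weight `b s`. -/
def inputMat {R : Type*} [Zero R] {n l : ℕ} (S : Finset (Fin n)) (c : Fin n → Fin l)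
    (b : Fin n → R) : Matrix (Fin n) (Fin l) R :=
  Matrix.of fun s j => if s ∈ S ∧ c s = j then b s else 0

lemma inputMat_map {R R' : Type*} [Zero R] [Zero R'] {n l : ℕ} (S : Finset (Fin n))
    (c : Fin n → Fin l) (b : Fin n → R) (f : R → R') (hf : f 0 = 0) :
    (inputMat S c b).map f = inputMat S c (fun s => f (b s)) := by
  ext s j
  simp only [inputMat, Matrix.map_apply, Matrix.of_apply]
  split_ifs <;> simp [hf]

lemma sparsity_inputMat_le {n l : ℕ} (S : Finset (Fin n)) (c : Fin n → Fin l) (b : Fin n → ℝ) :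
    sparsity (inputMat S c b) ≤ S.card := by
  refine Finset.card_le_card_of_injOn Prod.fst ?_ ?_
  · rintro ⟨s, j⟩ h
    simp [inputMat] at h ⊢
    exact h.1
  · rintro ⟨s, j⟩ h ⟨s', j'⟩ h' he
    simp [inputMat] at h h' he ⊢
    grind

/-- Actuating exactly the states of `J ⊆ S` with pairwise distinct inputs. -/
lemma eq_zero_of_vecMul_inputMat_indicator {n l : ℕ} {S J : Finset (Fin n)} (hJS : J ⊆ S)
    {c : Fin n → Fin l} (hc : Set.InjOn c J) {v : Fin n → ℂ}
    (hv : v ᵥ* inputMat S c (fun s => if s ∈ J then (1 : ℂ) else 0) = 0) :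
    ∀ s ∈ J, v s = 0 := by
  intro s hs
  have h := congrFun hv (c s)
  rw [Matrix.vecMul, dotProduct, Finset.sum_eq_single s] at h
  · simpa [inputMat, hs, hJS hs] using h
  · intro t _ hts
    simp only [inputMat, Matrix.of_apply]
    split_ifs with h1 h2
    · exact absurd (hc h2 hs h1.2) hts
    · simp
    · simp
  · simp

/-- Gram determinant of `[M | inputMat S c b]`, as a polynomial in the weights `b`. -/
def gramPoly {n l : ℕ} (M : Matrix (Fin n) (Fin n) ℂ) (S : Finset (Fin n)) (c : Fin n → Fin l) :
    MvPolynomial (Fin n) ℂ :=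
  ((M * Mᴴ).map MvPolynomial.C +
    inputMat (R := MvPolynomial (Fin n) ℂ) S c MvPolynomial.X *
      (inputMat (R := MvPolynomial (Fin n) ℂ) S c MvPolynomial.X)ᵀ).det

lemma eval_gramPoly {n l : ℕ} (M : Matrix (Fin n) (Fin n) ℂ) (S : Finset (Fin n))
    (c : Fin n → Fin l) (b : Fin n → ℂ) :
    MvPolynomial.eval b (gramPoly M S c) =
      (M * Mᴴ + inputMat S c b * (inputMat S c b)ᵀ).det := by
  have hX : (inputMat S c MvPolynomial.X).map (MvPolynomial.eval b) = inputMat S c b := by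
    rw [inputMat_map _ _ _ _ (map_zero _)]
    simp
  have hC : ((M * Mᴴ).map MvPolynomial.C).map (MvPolynomial.eval b) = M * Mᴴ := by
    rw [Matrix.map_map]
    convert Matrix.map_id _
    exact funext (MvPolynomial.eval_C (f := b))
  rw [gramPoly, RingHom.map_det, map_add, RingHom.mapMatrix_apply, RingHom.mapMatrix_apply, hC,
    Matrix.map_mul, Matrix.transpose_map, hX]

open scoped ComplexOrder in
lemma eval_gramPoly_ne_zero_iff {n l : ℕ} (M : Matrix (Fin n) (Fin n) ℂ) (S : Finset (Fin n))
    (c : Fin n → Fin l) (b : Fin n → ℝ) :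
    MvPolynomial.eval (fun s => (b s : ℂ)) (gramPoly M S c) ≠ 0 ↔
      ∀ v : Fin n → ℂ, v ᵥ* M = 0 → v ᵥ* inputMat S c (fun s => (b s : ℂ)) = 0 → v = 0 := by
  have hB : (inputMat S c fun s => (b s : ℂ))ᵀ = (inputMat S c fun s => (b s : ℂ))ᴴ := by
    rw [Matrix.conjTranspose, Matrix.transpose_map, inputMat_map _ _ _ _ (star_zero _)]
    simp
  rw [eval_gramPoly, hB, ← Matrix.fromCols_mul_fromRows,
    ← Matrix.conjTranspose_fromCols_eq_fromRows_conjTranspose, Ne,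
    ← Matrix.exists_vecMul_eq_zero_iff]
  simp only [Matrix.vecMul_self_mul_conjTranspose_eq_zero, Matrix.vecMul_fromCols]
  constructor
  · intro h v h1 h2
    by_contra hv
    exact h ⟨v, hv, by rw [h1, h2]; ext (_ | _) <;> rfl⟩
  · rintro h ⟨v, hv, he⟩
    exact hv (h v (funext fun i => congrFun he (Sum.inl i))
      (funext fun i => congrFun he (Sum.inr i)))

/-- Finitely many nonzero complex polynomials have a common real point of nonvanishing. -/
lemma exists_real_forall_eval_ne_zero {σ ι : Type*} [Fintype ι]
    (P : ι → MvPolynomial σ ℂ) (hP : ∀ i, P i ≠ 0) :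
    ∃ b : σ → ℝ, ∀ i, MvPolynomial.eval (fun s => (b s : ℂ)) (P i) ≠ 0 := by
  by_contra! h
  refine Finset.prod_ne_zero_iff.2 (fun i (_ : i ∈ Finset.univ) => hP i) ?_
  refine MvPolynomial.funext_set (fun _ => Set.range Complex.ofReal)
    (fun _ => Set.infinite_range_of_injective Complex.ofReal_injective) fun x hx => ?_
  choose b hb using fun s => hx s (Set.mem_univ s)
  obtain ⟨i, hi⟩ := h b
  rw [map_zero, map_prod]
  refine Finset.prod_eq_zero (Finset.mem_univ i) ?_
  rwa [← funext hb]

/-- If every family of left null vectors `M i` is separated by a rainbow set `J i ⊆ S` of states,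
some real weights make the resulting input matrix separate all of them at once. -/
lemma exists_weights {ι : Type*} [Fintype ι] {n l : ℕ} (M : ι → Matrix (Fin n) (Fin n) ℂ)
    (S : Finset (Fin n)) (c : Fin n → Fin l) (J : ι → Finset (Fin n)) (hJS : ∀ i, J i ⊆ S)
    (hc : ∀ i, Set.InjOn c (J i))
    (hJ : ∀ i (v : Fin n → ℂ), v ᵥ* M i = 0 → (∀ s ∈ J i, v s = 0) → v = 0) :
    ∃ b : Fin n → ℝ, ∀ i (v : Fin n → ℂ), v ᵥ* M i = 0 →
      v ᵥ* (inputMat S c b).map Complex.ofReal = 0 → v = 0 := by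
  obtain ⟨b, hb⟩ := exists_real_forall_eval_ne_zero (fun i => gramPoly (M i) S c) fun i h0 => by
    have := (eval_gramPoly_ne_zero_iff (M i) S c (fun s => if s ∈ J i then 1 else 0)).2
      fun v h1 h2 => hJ i v h1 (eq_zero_of_vecMul_inputMat_indicator (hJS i) (hc i) (by
        simpa only [apply_ite Complex.ofReal, Complex.ofReal_one, Complex.ofReal_zero] using h2))
    exact this (by rw [h0, map_zero])
  refine ⟨b, fun i v h1 h2 => (eval_gramPoly_ne_zero_iff (M i) S c b).1 (hb i) v h1 ?_⟩
  rwa [inputMat_map _ _ _ _ Complex.ofReal_zero] at h2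

lemma finrank_ker_vecMulLinear {K : Type*} [Field K] {n : ℕ} (M : Matrix (Fin n) (Fin n) K) :
    Module.finrank K (LinearMap.ker M.vecMulLinear) = n - M.rank := by
  have h := LinearMap.finrank_range_add_finrank_ker Mᵀ.mulVecLin
  rw [Module.finrank_fin_fun, Matrix.mulVecLin_transpose] at h
  rw [← Matrix.rank_transpose, Matrix.rank, Matrix.mulVecLin_transpose]
  omega

lemma vecMul_smul_one_sub_eq_zero_iff {K : Type*} [Field K] {n : ℕ}
    (M : Matrix (Fin n) (Fin n) K) (z : K) (v : Fin n → K) :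
    v ᵥ* (z • (1 : Matrix (Fin n) (Fin n) K) - M) = 0 ↔ v ᵥ* M = z • v := by
  rw [Matrix.vecMul_sub, Matrix.vecMul_smul, Matrix.vecMul_one, sub_eq_zero, eq_comm]

lemma mem_spectrum_of_vecMul_eq_smul {K : Type*} [Field K] {n : ℕ}
    {M : Matrix (Fin n) (Fin n) K} {z : K} {v : Fin n → K} (hv : v ≠ 0)
    (h : v ᵥ* M = z • v) : z ∈ spectrum K M := by
  rw [spectrum.mem_iff, Algebra.algebraMap_eq_smul_one, Matrix.isUnit_iff_isUnit_det,
    isUnit_iff_ne_zero, not_not, ← Matrix.exists_vecMul_eq_zero_iff]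
  exact ⟨v, hv, (vecMul_smul_one_sub_eq_zero_iff M z v).2 h⟩

lemma star_vecMul_map_ofReal {n : ℕ} {m : Type*} (M : Matrix (Fin n) m ℝ) (v : Fin n → ℂ) :
    star v ᵥ* M.map Complex.ofReal = star (v ᵥ* M.map Complex.ofReal) := by
  funext j
  simp [Matrix.vecMul, dotProduct]

theorem statement_16 {n pr q : ℕ} (A : Matrix (Fin n) (Fin n) ℝ)
    (μ : Fin (pr + q) → ℂ) (hμ : Function.Injective μ)
    (hspec : spectrum ℂ (A.map Complex.ofReal) =
      Set.range μ ∪ (starRingEnd ℂ) '' Set.range μ)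
    (hreal : ∀ i : Fin (pr + q), (i : ℕ) < pr ↔ (μ i).im = 0)
    (k : Fin (pr + q) → ℕ)
    (hk : ∀ i, k i =
      n - (μ i • (1 : Matrix (Fin n) (Fin n) ℂ) - A.map Complex.ofReal).rank)
    (kmax : ℕ) (istar : Fin (pr + q))
    (hstar : k istar = kmax) (hub : ∀ i, k i ≤ kmax)
    (huniq : ∀ i, k i = kmax → i = istar)
    (hsum : ∑ i ∈ Finset.univ.erase istar, k i * (k i - 1) / 2 < kmax) :
    ∀ l : ℕ, kmax ≤ l → MSCPopt A l = MACPopt A := by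
  intro l hl
  obtain ⟨S, hS, hScard⟩ := exists_controllable_diagSel_card_eq_MACPopt A
  rw [controllable_diagSel_iff] at hS
  let M : Fin (pr + q) → Matrix (Fin n) (Fin n) ℂ := fun i => μ i • 1 - A.map Complex.ofReal
  have hM : ∀ i v, v ᵥ* M i = 0 ↔ v ᵥ* A.map Complex.ofReal = μ i • v :=
    fun i v => vecMul_smul_one_sub_eq_zero_iff _ _ _
  have hbasis : ∀ i, ∃ J ⊆ S, J.card ≤ k i ∧
      ∀ v : Fin n → ℂ, v ᵥ* M i = 0 → (∀ s ∈ J, v s = 0) → v = 0 := fun i => by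
    obtain ⟨J, hJS, hJc, hJ⟩ := exists_subset_card_le_finrank S
      (LinearMap.ker (M i).vecMulLinear) fun v hv => hS (μ i) v ((hM i v).1 hv)
    refine ⟨J, hJS, ?_, fun v hv => hJ v hv⟩
    rwa [finrank_ker_vecMulLinear, ← hk i] at hJc
  choose J hJS hJc hJ using hbasis
  obtain ⟨c, hc₀, hc⟩ := exists_coloring_injOn (Finset.univ.erase istar) (J istar) J
    ((hJc istar).trans (hstar.le.trans hl)) (lt_of_le_of_lt (Finset.sum_le_sum fun i _ =>
      Nat.div_le_div_right (Nat.mul_le_mul (hJc i) (Nat.sub_le_sub_right (hJc i) 1)))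
      (hsum.trans_le hl))
  have hcinj : ∀ i, Set.InjOn c (J i) := fun i => by
    by_cases hi : i = istar
    · exact hi ▸ hc₀
    · exact hc i (Finset.mem_erase.2 ⟨hi, Finset.mem_univ i⟩)
  obtain ⟨b, hb⟩ := exists_weights M S c J hJS hcinj hJ
  have hctrb : Controllable A (inputMat S c b) := by
    rw [controllable_real_iff]
    intro z v hA hB
    by_contra hv
    have hz := mem_spectrum_of_vecMul_eq_smul hv hA
    rw [hspec] at hz
    rcases hz with ⟨i, rfl⟩ | ⟨_, ⟨i, rfl⟩, rfl⟩
    · exact hv (hb i v ((hM i v).2 hA) hB)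
    · refine hv (star_eq_zero.1 (hb i (star v) ((hM i _).2 ?_) ?_))
      · rw [star_vecMul_map_ofReal, hA, star_smul, ← starRingEnd_apply, Complex.conj_conj]
      · rw [star_vecMul_map_ofReal, hB, star_zero]
  refine le_antisymm ?_ ?_
  · have hle : MSCPopt A l ≤ sparsity (inputMat S c b) := Nat.sInf_le ⟨_, hctrb, rfl⟩
    exact hle.trans ((sparsity_inputMat_le S c b).trans hScard.le)
  · refine le_csInf ⟨_, _, hctrb, rfl⟩ ?_
    rintro _ ⟨B, hB, rfl⟩
    exact MACPopt_le_sparsity hB
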